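/- (Restricted Rényi–Joyal bijection) Let 1 ≤ k < n, S = {1,…,k} and S^c = {k+1,…,n}. There exists a bijection R̃ from the set of functions {f : {1,…,n} → {1,…,n} with f(S) ⊆ S^c} to the set of doubly rooted trees (T, r1, r2) on n vertices such that S is an independent set in T and r2 ∈ S^c, with the property that for every such f, the symmetric difference of the undirected edge multiset E(f) of the functional graph of f and the edge set of the tree has size at most 2·c(f), where c(f) is the number of cycles of f. -/

import Mathlib

open scoped Classical

/-- The core of a self-map: the set of points lying on a cycle,
i.e. `x` with `f^[j] x = x` for some `j ≥ 1`. -/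
def inCore {V : Type*} (f : V → V) (x : V) : Prop := ∃ j ≥ 1, f^[j] x = x

/-- The number of cycles of a self-map: the number of distinct forward orbits
of points of the core (each cycle is the forward orbit of any of its points). -/
noncomputable def cycleCount {V : Type*} (f : V → V) : ℕ :=
  Set.ncard ((fun x => {y | ∃ j : ℕ, f^[j] x = y}) '' {x | inCore f x})

/-- The undirected edge multiset of the functional graph of `f` : the multiset of
unordered pairs `{x, f x}`, with multiplicity, loops allowed. -/
def funEdges {n : ℕ} (f : Fin n → Fin n) : Multiset (Sym2 (Fin n)) :=
  Finset.univ.val.map (fun x => s(x, f x))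

/-- The edge multiset of a simple graph on `Fin n` (each edge counted once). -/
noncomputable def graphEdges {n : ℕ} (G : SimpleGraph (Fin n)) : Multiset (Sym2 (Fin n)) :=
  (G.edgeSet.toFinite.toFinset).val

/-- Size of the multiset symmetric difference `(A - B) + (B - A)`. -/
noncomputable def msdCard {α : Type*} (A B : Multiset α) : ℕ :=
  Multiset.card ((A - B) + (B - A))

/-- A doubly rooted tree on `n` vertices: a tree on vertex set `Fin n`
together with an ordered pair of roots. -/
structure DoublyRootedTree (n : ℕ) where
  tree : SimpleGraph (Fin n)
  isTree : tree.IsTree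
  r1 : Fin n
  r2 : Fin n

section Reach

variable {V : Type*} {f g : V → V} {x y z : V}

/-- `y` lies on the forward orbit of `x` under `f`. -/
def Reach (f : V → V) (x y : V) : Prop := ∃ j : ℕ, f^[j] x = y

theorem Reach.refl (f : V → V) (x : V) : Reach f x x := ⟨0, rfl⟩

theorem Reach.step (f : V → V) (x : V) : Reach f x (f x) := ⟨1, rfl⟩

theorem Reach.trans (h : Reach f x y) (h' : Reach f y z) : Reach f x z := by
  obtain ⟨i, rfl⟩ := h
  obtain ⟨j, rfl⟩ := h'
  exact ⟨j + i, Function.iterate_add_apply f j i x⟩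

theorem Reach.total (h : Reach f x y) (h' : Reach f x z) : Reach f y z ∨ Reach f z y := by
  obtain ⟨i, rfl⟩ := h
  obtain ⟨j, rfl⟩ := h'
  rcases le_total i j with hij | hij
  · exact Or.inl ⟨j - i, by rw [← Function.iterate_add_apply, Nat.sub_add_cancel hij]⟩
  · exact Or.inr ⟨i - j, by rw [← Function.iterate_add_apply, Nat.sub_add_cancel hij]⟩

theorem Reach.eq_or (h : Reach f x y) : x = y ∨ Reach f (f x) y := by
  obtain ⟨_ | j, h⟩ := h
  · exact Or.inl h
  · exact Or.inr ⟨j, h⟩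

theorem Reach.invariant {P : V → Prop} (h : Reach f x y) (hx : P x)
    (hf : ∀ z, P z → P (f z)) : P y := by
  obtain ⟨j, rfl⟩ := h
  induction j generalizing x with
  | zero => exact hx
  | succ j ih => exact ih (hf x hx)

theorem inCore_iff : inCore f x ↔ Reach f (f x) x := by
  constructor
  · rintro ⟨_ | j, hj, h⟩
    · omega
    · exact ⟨j, h⟩
  · rintro ⟨j, h⟩
    exact ⟨j + 1, by omega, h⟩

theorem Reach.symm_of_inCore (hx : inCore f x) (h : Reach f x y) : Reach f y x := by
  refine h.invariant (P := fun z => Reach f z x) (Reach.refl f x) fun z hz => ?_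
  rcases hz.eq_or with rfl | hz
  · exact inCore_iff.1 hx
  · exact hz

theorem Reach.inCore (hx : inCore f x) (h : Reach f x y) : inCore f y :=
  inCore_iff.2 (((h.trans (Reach.step f y)).symm_of_inCore hx).trans h)

theorem exists_reach_inCore [Finite V] (f : V → V) (x : V) : ∃ y, Reach f x y ∧ inCore f y := by
  obtain ⟨i, j, hij, h⟩ := Finite.exists_ne_map_eq_of_infinite fun j : ℕ => f^[j] x
  wlog hlt : i < j generalizing i j
  · exact this j i hij.symm h.symm (by omega)
  refine ⟨f^[i] x, ⟨i, rfl⟩, j - i, by omega, ?_⟩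
  rw [← Function.iterate_add_apply, Nat.sub_add_cancel hlt.le]
  exact h.symm

/-- The first element of `A` on the orbit of `x` is reached by any map agreeing with `f` off `A`. -/
theorem Reach.exists_first {A : Set V} (hA : ∀ x ∉ A, g x = f x) (hy : y ∈ A)
    (h : Reach f x y) : ∃ a ∈ A, Reach f x a ∧ Reach g x a ∧
      ∀ b ∈ A, Reach f x b → Reach f a b := by
  obtain ⟨j, h⟩ := h
  induction j generalizing x with
  | zero =>
    obtain rfl : x = y := h
    exact ⟨x, hy, Reach.refl f x, Reach.refl g x, fun _ _ hb => hb⟩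
  | succ j ih =>
    by_cases hx : x ∈ A
    · exact ⟨x, hx, Reach.refl f x, Reach.refl g x, fun _ _ hb => hb⟩
    · obtain ⟨a, ha, hfa, hga, hfirst⟩ := ih h
      refine ⟨a, ha, (Reach.step f x).trans hfa,
        (Reach.step g x).trans (by rwa [hA x hx]), fun b hb hxb => ?_⟩
      rcases hxb.eq_or with rfl | hxb
      · exact absurd hb hx
      · exact hfirst b hb hxb

/-- Every point flows to the fixed point `r` under `g`: the map `g` is the parent map of a
tree rooted at `r`. -/
def IsParentMap (g : V → V) (r : V) : Prop := g r = r ∧ ∀ x, Reach g x r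

namespace IsParentMap

variable {r : V}

theorem eq_of_reach_root (hg : IsParentMap g r) (h : Reach g r x) : x = r :=
  h.invariant (P := fun z => z = r) rfl fun z hz => by rw [hz, hg.1]

theorem eq_root_of_inCore (hg : IsParentMap g r) (h : inCore g x) : x = r :=
  hg.eq_of_reach_root ((hg.2 x).symm_of_inCore h)

theorem antisymm (hg : IsParentMap g r) (h : Reach g x y) (h' : Reach g y x) : x = y := by
  rcases h.eq_or with rfl | h
  · rfl
  · obtain rfl := hg.eq_root_of_inCore (inCore_iff.2 (h.trans h'))
    exact (hg.eq_of_reach_root ((Reach.step g x).trans h)).symm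

theorem eq_root_of_fixed (hg : IsParentMap g r) (h : g x = x) : x = r :=
  hg.eq_root_of_inCore ⟨1, le_rfl, h⟩

end IsParentMap

end Reach

section Shift

variable {V : Type*} [LinearOrder V]

/-- The largest elements of the cycles of `f`. -/
def cycleMaxima (f : V → V) : Set V := {x | inCore f x ∧ ∀ y, Reach f x y → y ≤ x}

/-- The points of the orbit of `s` that dominate all later points (right-to-left maxima). -/
def orbitRecords (g : V → V) (s : V) : Set V := {x | Reach g s x ∧ ∀ y, Reach g x y → y ≤ x}

/-- `a` and `b` are consecutive elements of `A`. -/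
def Consecutive (A : Set V) (a b : V) : Prop :=
  a ∈ A ∧ b ∈ A ∧ a < b ∧ ∀ c ∈ A, c < b → c ≤ a

/-- `(g, s)` is obtained from `f` by shifting the values of `f` on `A` by one position. -/
structure IsShift (A : Set V) (f g : V → V) (s : V) : Prop where
  off : ∀ x ∉ A, g x = f x
  consecutive : ∀ a b, Consecutive A a b → g b = f a
  least : ∀ a, IsLeast A a → g a = a
  greatest : ∀ a, IsGreatest A a → s = f a

variable {A : Set V} {f f' g g' : V → V} {s s' r : V}

theorem isLeast_or_exists_consecutive [Finite V] {a : V} (ha : a ∈ A) :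
    IsLeast A a ∨ ∃ b, Consecutive A b a := by
  by_cases h : ∃ b ∈ A, b < a
  · obtain ⟨b, hb, hmax⟩ := Set.exists_max_image {b | b ∈ A ∧ b < a} id (Set.toFinite _) h
    exact Or.inr ⟨b, hb.1, ha, hb.2, fun c hc hca => hmax c ⟨hc, hca⟩⟩
  · push Not at h
    exact Or.inl ⟨ha, h⟩

theorem isGreatest_or_exists_consecutive [Finite V] {a : V} (ha : a ∈ A) :
    IsGreatest A a ∨ ∃ b, Consecutive A a b := by
  by_cases h : ∃ b ∈ A, a < b
  · obtain ⟨b, hb, hmin⟩ := Set.exists_min_image {b | b ∈ A ∧ a < b} id (Set.toFinite _) h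
    exact Or.inr ⟨b, ha, hb.1, hb.2, fun c hc hcb =>
      not_lt.1 fun hac => (hmin c ⟨hc, hac⟩).not_gt hcb⟩
  · push Not at h
    exact Or.inl ⟨ha, h⟩

theorem exists_isGreatest [Finite V] (hA : A.Nonempty) : ∃ a, IsGreatest A a := by
  obtain ⟨a, ha, h⟩ := Set.exists_max_image A id (Set.toFinite _) hA
  exact ⟨a, ha, h⟩

theorem exists_isLeast [Finite V] (hA : A.Nonempty) : ∃ a, IsLeast A a := by
  obtain ⟨a, ha, h⟩ := Set.exists_min_image A id (Set.toFinite _) hA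
  exact ⟨a, ha, h⟩

theorem Consecutive.left_unique {a a' b : V} (h : Consecutive A a b) (h' : Consecutive A a' b) :
    a = a' :=
  le_antisymm (h'.2.2.2 a h.1 h.2.2.1) (h.2.2.2 a' h'.1 h'.2.2.1)

theorem Consecutive.right_unique {a b b' : V} (h : Consecutive A a b) (h' : Consecutive A a b') :
    b = b' :=
  le_antisymm (not_lt.1 fun hlt => (h.2.2.2 b' h'.2.1 hlt).not_gt h'.2.2.1)
    (not_lt.1 fun hlt => (h'.2.2.2 b h.2.1 hlt).not_gt h.2.2.1)

theorem exists_isShift_of_source [Finite V] (hA : A.Nonempty) (f : V → V)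
    : ∃ g s, IsShift A f g s := by
  obtain ⟨m, hm⟩ := exists_isGreatest hA
  refine ⟨fun x => if x ∈ A then if h : ∃ b, Consecutive A b x then f h.choose else x else f x,
    f m, fun x hx => by simp [hx], fun a b h => ?_, fun a ha => ?_, fun a ha => ?_⟩
  · have hex : ∃ c, Consecutive A c b := ⟨a, h⟩
    simp only [h.2.1, hex, if_true, dif_pos]
    rw [hex.choose_spec.left_unique h]
  · have hex : ¬ ∃ c, Consecutive A c a := fun ⟨c, hc⟩ => (ha.2 hc.1).not_gt hc.2.2.1
    simp only [hex, dif_neg, not_false_eq_true, ha.1, if_true]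
  · rw [ha.unique hm]

theorem exists_isShift_of_target (g : V → V) (s : V) (hleast : ∀ a, IsLeast A a → g a = a) :
    ∃ f, IsShift A f g s := by
  refine ⟨fun x => if x ∈ A then if h : ∃ b, Consecutive A x b then g h.choose else s else g x,
    fun x hx => by simp [hx], fun a b h => ?_, hleast, fun a ha => ?_⟩
  · have hex : ∃ c, Consecutive A a c := ⟨b, h⟩
    simp only [h.1, hex, if_true, dif_pos]
    rw [hex.choose_spec.right_unique h]
  · have hex : ¬ ∃ c, Consecutive A a c := fun ⟨c, hc⟩ => (ha.2 hc.2.1).not_gt hc.2.2.1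
    simp only [hex, dif_neg, not_false_eq_true, ha.1, if_true]

namespace IsShift

theorem target_unique [Finite V] (hA : A.Nonempty) (h : IsShift A f g s) (h' : IsShift A f g' s') :
    g = g' ∧ s = s' := by
  constructor
  · funext x
    by_cases hx : x ∈ A
    · rcases isLeast_or_exists_consecutive hx with hl | ⟨b, hb⟩
      · rw [h.least x hl, h'.least x hl]
      · rw [h.consecutive b x hb, h'.consecutive b x hb]
    · rw [h.off x hx, h'.off x hx]
  · obtain ⟨m, hm⟩ := exists_isGreatest hA
    rw [h.greatest m hm, h'.greatest m hm]

theorem source_unique [Finite V] (h : IsShift A f g s) (h' : IsShift A f' g s) : f = f' := by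
  funext x
  by_cases hx : x ∈ A
  · rcases isGreatest_or_exists_consecutive hx with hl | ⟨b, hb⟩
    · rw [← h.greatest x hl, ← h'.greatest x hl]
    · rw [← h.consecutive x b hb, ← h'.consecutive x b hb]
  · rw [← h.off x hx, ← h'.off x hx]

end IsShift

theorem exists_reach_mem_cycleMaxima [Finite V] (f : V → V) (x : V)
    : ∃ a ∈ cycleMaxima f, Reach f x a := by
  obtain ⟨y, hxy, hy⟩ := exists_reach_inCore f x
  obtain ⟨a, ha, hmax⟩ :=
    Set.exists_max_image {z | Reach f y z} id (Set.toFinite _) ⟨y, Reach.refl f y⟩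
  exact ⟨a, ⟨ha.inCore hy, fun z hz => hmax z (ha.trans hz)⟩, hxy.trans ha⟩

theorem eq_of_reach_of_mem_cycleMaxima {a b : V} (ha : a ∈ cycleMaxima f)
    (hb : b ∈ cycleMaxima f) (h : Reach f a b) : a = b :=
  le_antisymm (hb.2 a (h.symm_of_inCore ha.1)) (ha.2 b h)

namespace IsShift

theorem exists_reach [Finite V] (h : IsShift (cycleMaxima f) f g s) (x : V) :
    ∃ a ∈ cycleMaxima f, Reach f x a ∧ Reach g x a := by
  obtain ⟨a, ha, hxa⟩ := exists_reach_mem_cycleMaxima f x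
  obtain ⟨b, hb, hfb, hgb, -⟩ := hxa.exists_first h.off ha
  exact ⟨b, hb, hfb, hgb⟩

theorem reach_of_cycle [Finite V] (h : IsShift (cycleMaxima f) f g s)
    {a y : V} (ha : a ∈ cycleMaxima f)
    (hy : Reach f a y) : Reach g y a := by
  obtain ⟨b, hb, hfb, hgb⟩ := h.exists_reach y
  rwa [eq_of_reach_of_mem_cycleMaxima ha hb (hy.trans hfb)]

theorem isParentMap [Finite V] (h : IsShift (cycleMaxima f) f g s)
    (hr : IsLeast (cycleMaxima f) r) :
    IsParentMap g r := by
  refine ⟨h.least r hr, fun x => ?_⟩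
  obtain ⟨a, ha, -, hxa⟩ := h.exists_reach x
  refine hxa.trans ?_
  clear hxa x
  induction a using WellFoundedLT.induction with
  | _ a ih =>
    rcases isLeast_or_exists_consecutive ha with hl | ⟨b, hb⟩
    · rw [hl.unique hr]
      exact Reach.refl g r
    · refine (Reach.step g a).trans (Reach.trans ?_ (ih b hb.2.2.1 hb.1))
      rw [h.consecutive b a hb]
      exact h.reach_of_cycle hb.1 (Reach.step f b)

theorem reach_of_mem [Finite V] (h : IsShift (cycleMaxima f) f g s)
    {a : V} (ha : a ∈ cycleMaxima f) :
    Reach g s a := by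
  induction a using WellFoundedGT.induction with
  | _ a ih =>
    have hfa := h.reach_of_cycle ha (Reach.step f a)
    rcases isGreatest_or_exists_consecutive ha with hl | ⟨b, hb⟩
    · rwa [h.greatest a hl]
    · refine (ih b hb.2.2.1 hb.2.1).trans ((Reach.step g b).trans ?_)
      rwa [h.consecutive a b hb]

theorem exists_cycle_of_reach [Finite V] (h : IsShift (cycleMaxima f) f g s) {a x y : V}
    (ha : a ∈ cycleMaxima f) (hx : Reach f a x) (hy : Reach g x y) :
    ∃ b ∈ cycleMaxima f, b ≤ a ∧ Reach f b y := by
  refine hy.invariant (P := fun y => ∃ b ∈ cycleMaxima f, b ≤ a ∧ Reach f b y)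
    ⟨a, ha, le_rfl, hx⟩ ?_
  rintro z ⟨b, hb, hba, hbz⟩
  by_cases hz : z ∈ cycleMaxima f
  · obtain rfl := eq_of_reach_of_mem_cycleMaxima hb hz hbz
    rcases isLeast_or_exists_consecutive hz with hl | ⟨c, hc⟩
    · exact ⟨b, hb, hba, by rw [h.least b hl]; exact Reach.refl f b⟩
    · exact ⟨c, hc.1, hc.2.2.1.le.trans hba, by
        rw [h.consecutive c b hc]; exact Reach.step f c⟩
  · exact ⟨b, hb, hba, by rw [h.off z hz]; exact hbz.trans (Reach.step f z)⟩

theorem orbitRecords_eq [Finite V] (h : IsShift (cycleMaxima f) f g s) :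
    orbitRecords g s = cycleMaxima f := by
  ext x
  constructor
  · rintro ⟨hsx, hx⟩
    obtain ⟨a, ha, -⟩ := exists_reach_mem_cycleMaxima f s
    obtain ⟨m, hm⟩ := exists_isGreatest ⟨a, ha⟩
    obtain ⟨b, hb, -, hbx⟩ := h.exists_cycle_of_reach hm.1
      (by rw [h.greatest m hm]; exact Reach.step f m) hsx
    rwa [le_antisymm (hb.2 x hbx) (hx b (h.reach_of_cycle hb hbx))]
  · intro hx
    refine ⟨h.reach_of_mem hx, fun y hy => ?_⟩
    obtain ⟨b, hb, hbx, hby⟩ := h.exists_cycle_of_reach hx (Reach.refl f x) hy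
    exact (hb.2 y hby).trans hbx

end IsShift

namespace IsParentMap

theorem isLeast_orbitRecords (hg : IsParentMap g r) (s : V) : IsLeast (orbitRecords g s) r :=
  ⟨⟨hg.2 s, fun _ hy => (hg.eq_of_reach_root hy).le⟩, fun b hb => hb.2 r (hg.2 b)⟩

theorem reach_of_lt {b c : V} (hb : b ∈ orbitRecords g s) (hc : c ∈ orbitRecords g s)
    (hbc : b < c) : Reach g c b :=
  (hb.1.total hc.1).resolve_left fun h => (hb.2 c h).not_gt hbc

theorem exists_first (hg : IsParentMap g r) (h : IsShift (orbitRecords g s) f g s) (x : V) :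
    ∃ b ∈ orbitRecords g s, Reach g x b ∧ Reach f x b ∧
      ∀ c ∈ orbitRecords g s, Reach g x c → Reach g b c :=
  (hg.2 x).exists_first (fun x hx => (h.off x hx).symm) (hg.isLeast_orbitRecords s).1

theorem reach_apply [Finite V] (hg : IsParentMap g r) (h : IsShift (orbitRecords g s) f g s) {b : V}
    (hb : b ∈ orbitRecords g s) :
    Reach g s (f b) ∧ Reach f (f b) b ∧ Reach g (f b) b ∧
      ∀ c ∈ orbitRecords g s, Reach g (f b) c → Reach g b c := by
  obtain ⟨b', hb', hgb', hfb', hfirst⟩ := hg.exists_first h (f b)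
  suffices hs : Reach g s (f b) ∧ b' = b by
    obtain ⟨hs, rfl⟩ := hs
    exact ⟨hs, hfb', hgb', hfirst⟩
  rcases isGreatest_or_exists_consecutive hb with hl | ⟨c, hc⟩
  · rw [← h.greatest b hl] at hfirst ⊢
    exact ⟨Reach.refl g s, le_antisymm (hl.2 hb') (hb'.2 b (hfirst b hb hb.1))⟩
  · rw [← h.consecutive b c hc] at hfirst hgb' ⊢
    have hcb := reach_of_lt hb hc.2.1 hc.2.2.1
    have hgcb : Reach g (g c) b := hcb.eq_or.resolve_left hc.2.2.1.ne'
    refine ⟨hc.2.1.1.trans (Reach.step g c), ?_⟩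
    refine le_antisymm (hc.2.2.2 b' hb' ?_) (hb'.2 b (hfirst b hb hgcb))
    refine lt_of_le_of_ne (hc.2.1.2 b' ((Reach.step g c).trans hgb')) ?_
    rintro rfl
    obtain rfl := hg.eq_root_of_inCore (inCore_iff.2 hgb')
    exact hc.2.2.1.ne (hg.eq_of_reach_root hcb)

theorem le_of_reach [Finite V] (hg : IsParentMap g r) (h : IsShift (orbitRecords g s) f g s)
    {b y : V}
    (hb : b ∈ orbitRecords g s) (hy : Reach f b y) : y ≤ b := by
  obtain ⟨hsy, -, hfirst⟩ := hy.invariant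
    (P := fun y => Reach g s y ∧ Reach g y b ∧ ∀ c ∈ orbitRecords g s, Reach g y c → Reach g b c)
    ⟨hb.1, Reach.refl g b, fun _ _ hc => hc⟩ (by
      rintro z ⟨hsz, hzb, hz⟩
      by_cases hzB : z ∈ orbitRecords g s
      · obtain rfl := hg.antisymm hzb (hz z hzB (Reach.refl g z))
        obtain ⟨h1, -, h2, h3⟩ := hg.reach_apply h hb
        exact ⟨h1, h2, h3⟩
      · rw [← h.off z hzB]
        refine ⟨hsz.trans (Reach.step g z), hzb.eq_or.resolve_left ?_,
          fun c hc hzc => hz c hc ((Reach.step g z).trans hzc)⟩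
        rintro rfl
        exact hzB hb)
  obtain ⟨m, hm, hmax⟩ :=
    Set.exists_max_image {z | Reach g y z} id (Set.toFinite _) ⟨y, Reach.refl g y⟩
  have hmB : m ∈ orbitRecords g s := ⟨hsy.trans hm, fun z hz => hmax z (Reach.trans hm hz)⟩
  exact (hmax y (Reach.refl g y)).trans (hb.2 m (hfirst m hmB hm))

theorem cycleMaxima_eq [Finite V] (hg : IsParentMap g r) (h : IsShift (orbitRecords g s) f g s) :
    cycleMaxima f = orbitRecords g s := by
  ext x
  constructor
  · rintro ⟨hx, hmax⟩
    obtain ⟨b, hb, -, hxb, -⟩ := hg.exists_first h x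
    rwa [le_antisymm (hg.le_of_reach h hb (hxb.symm_of_inCore hx)) (hmax b hxb)]
  · intro hx
    exact ⟨inCore_iff.2 (hg.reach_apply h hx).2.1, fun y hy => hg.le_of_reach h hx hy⟩

end IsParentMap

end Shift

section ParentGraph

variable {V : Type*} {g g' : V → V} {r : V} {G : SimpleGraph V}

/-- The simple graph joining every `x` to `g x`. -/
def parentGraph (g : V → V) : SimpleGraph V := SimpleGraph.fromRel fun x y => g x = y

theorem parentGraph_adj {x y : V} : (parentGraph g).Adj x y ↔ x ≠ y ∧ (g x = y ∨ g y = x) :=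
  SimpleGraph.fromRel_adj _ x y

theorem Reach.reachable {x y : V} (h : Reach g x y) : (parentGraph g).Reachable x y := by
  refine h.invariant (P := fun z => (parentGraph g).Reachable x z) (SimpleGraph.Reachable.refl x)
    fun z hz => ?_
  by_cases hzg : z = g z
  · rwa [← hzg]
  · exact hz.trans (parentGraph_adj.2 ⟨hzg, Or.inl rfl⟩ : (parentGraph g).Adj z (g z)).reachable

namespace IsParentMap

theorem connected (hg : IsParentMap g r) : (parentGraph g).Connected :=
  (SimpleGraph.connected_iff _).2
    ⟨fun x y => (hg.2 x).reachable.trans (hg.2 y).reachable.symm, ⟨r⟩⟩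

theorem edgeSet_eq (hg : IsParentMap g r) :
    (parentGraph g).edgeSet = (fun x => s(x, g x)) '' {x | x ≠ r} := by
  ext e
  induction e using Sym2.ind with
  | _ x y =>
    rw [SimpleGraph.mem_edgeSet, parentGraph_adj]
    constructor
    · rintro ⟨hxy, rfl | rfl⟩
      · exact ⟨x, fun h => hxy (by rw [h, hg.1]), rfl⟩
      · exact ⟨y, fun h => hxy (by rw [h, hg.1]), Sym2.eq_swap⟩
    · rintro ⟨z, hz, h⟩
      have hne : z ≠ g z := fun h => hz (hg.eq_root_of_fixed h.symm)
      rcases Sym2.eq_iff.1 h with ⟨rfl, rfl⟩ | ⟨rfl, rfl⟩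
      · exact ⟨hne, Or.inl rfl⟩
      · exact ⟨hne.symm, Or.inr rfl⟩

theorem ncard_edgeSet [Finite V] (hg : IsParentMap g r) :
    (parentGraph g).edgeSet.ncard = {x | x ≠ r}.ncard := by
  have h1 := hg.connected.card_vert_le_card_edgeSet_add_one
  have h2 : (parentGraph g).edgeSet.ncard ≤ {x | x ≠ r}.ncard := by
    rw [hg.edgeSet_eq]
    exact Set.ncard_image_le (Set.toFinite _)
  have h3 := Set.ncard_add_ncard_compl {r}
  rw [Set.ncard_singleton] at h3
  change 1 + {x | x ≠ r}.ncard = _ at h3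
  rw [Nat.card_coe_set_eq] at h1
  omega

theorem isTree [Finite V] (hg : IsParentMap g r) : (parentGraph g).IsTree := by
  refine SimpleGraph.isTree_iff_connected_and_card.2 ⟨hg.connected, ?_⟩
  have h3 := Set.ncard_add_ncard_compl {r}
  rw [Set.ncard_singleton] at h3
  change 1 + {x | x ≠ r}.ncard = _ at h3
  rw [Nat.card_coe_set_eq, hg.ncard_edgeSet]
  omega

theorem injOn_edge [Finite V] (hg : IsParentMap g r) :
    Set.InjOn (fun x => s(x, g x)) {x | x ≠ r} := by
  rw [← Set.ncard_image_iff (Set.toFinite _), ← hg.edgeSet_eq, hg.ncard_edgeSet]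

theorem parentGraph_injective (hg : IsParentMap g r) (hg' : IsParentMap g' r)
    (h : parentGraph g = parentGraph g') : g = g' := by
  funext x
  by_contra hx
  refine (hg'.2 x).invariant (P := fun z => g z ≠ g' z) hx ?_ (hg.1.trans hg'.1.symm)
  intro z hz hz'
  have hzr : z ≠ r := fun h => hz (by rw [h, hg.1, hg'.1])
  have hne : z ≠ g' z := fun h => hzr (hg'.eq_root_of_fixed h.symm)
  have hadj : (parentGraph g').Adj z (g' z) := parentGraph_adj.2 ⟨hne, Or.inl rfl⟩
  rw [← h] at hadj
  have hback := (parentGraph_adj.1 hadj).2.resolve_left hz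
  exact hzr (hg'.eq_root_of_inCore ⟨2, by omega, hz'.symm.trans hback⟩)

end IsParentMap

theorem SimpleGraph.IsTree.exists_parentMap (hG : G.IsTree) (r : V) :
    ∃ g, IsParentMap g r ∧ parentGraph g = G := by
  have hex : ∀ x, ∃ y, (x = r → y = r) ∧ (x ≠ r → G.Adj x y ∧ G.dist y r < G.dist x r) := by
    intro x
    by_cases hx : x = r
    · exact ⟨r, fun _ => rfl, fun h => absurd hx h⟩
    · obtain ⟨p, hp⟩ := (hG.connected x r).exists_walk_length_eq_dist
      cases p with
      | nil => exact absurd rfl hx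
      | cons hadj q =>
        refine ⟨_, fun h => absurd h hx, fun _ => ⟨hadj, ?_⟩⟩
        rw [← hp, SimpleGraph.Walk.length_cons]
        exact Nat.lt_succ_of_le (SimpleGraph.dist_le q)
  choose g hgr hg using hex
  have hpar : IsParentMap g r := by
    refine ⟨hgr r rfl, fun x => ?_⟩
    induction hd : G.dist x r using Nat.strong_induction_on generalizing x with
    | _ d ih =>
      by_cases hx : x = r
      · exact hx ▸ Reach.refl g x
      · exact (Reach.step g x).trans (ih _ (hd ▸ (hg x hx).2) _ rfl)
  refine ⟨g, hpar, ?_⟩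
  have hadj : ∀ x, x ≠ g x → G.Adj x (g x) := fun x hx =>
    (hg x fun h => hx (by rw [hgr x h, h])).1
  have hle : parentGraph g ≤ G := by
    intro x y hxy
    obtain ⟨hne, rfl | rfl⟩ := parentGraph_adj.1 hxy
    · exact hadj x hne
    · exact (hadj y hne.symm).symm
  exact le_antisymm hle
    ((SimpleGraph.isTree_iff_minimal_connected.1 hG).le_of_le hpar.connected hle)

end ParentGraph

section EdgeCount

theorem ncard_cycleMaxima_le {V : Type*} [LinearOrder V] [Finite V] (f : V → V) :
    (cycleMaxima f).ncard ≤ cycleCount f := by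
  refine Set.ncard_le_ncard_of_injOn (fun x => {y | ∃ j : ℕ, f^[j] x = y})
    (fun x hx => ⟨x, hx.1, rfl⟩) (fun x hx y hy hxy => ?_) (Set.toFinite _)
  refine eq_of_reach_of_mem_cycleMaxima hx hy ?_
  have : y ∈ {z | ∃ j : ℕ, f^[j] x = z} := by
    rw [show {z | ∃ j : ℕ, f^[j] x = z} = {z | ∃ j : ℕ, f^[j] y = z} from hxy]
    exact Reach.refl f y
  exact this

theorem msdCard_add_le {α : Type*} (A B C : Multiset α) :
    msdCard (A + C) (B + C) ≤ A.card + B.card := by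
  rw [msdCard, add_tsub_add_eq_tsub_right, add_tsub_add_eq_tsub_right, Multiset.card_add]
  exact add_le_add (Multiset.card_le_card tsub_le_self) (Multiset.card_le_card tsub_le_self)

variable {n : ℕ} {f g : Fin n → Fin n} {s r : Fin n}

theorem IsParentMap.graphEdges_eq (hg : IsParentMap g r) :
    graphEdges (parentGraph g) = (Finset.univ.erase r).val.map fun x => s(x, g x) := by
  have hinj : Set.InjOn (fun x => s(x, g x)) (Finset.univ.erase r : Finset (Fin n)) := by
    intro x hx y hy
    exact hg.injOn_edge (by simpa using hx) (by simpa using hy)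
  rw [← Finset.image_val_of_injOn hinj, graphEdges]
  congr 1
  ext e
  rw [Set.Finite.mem_toFinset, hg.edgeSet_eq]
  simp

theorem IsShift.msdCard_le {A : Set (Fin n)} (h : IsShift A f g s) (hg : IsParentMap g r)
    (hr : r ∈ A) : msdCard (funEdges f) (graphEdges (parentGraph g)) ≤ 2 * A.ncard := by
  have hcard : ∀ t : Finset (Fin n), (t.filter (· ∈ A)).card ≤ A.ncard := by
    intro t
    rw [← Set.ncard_coe_finset]
    exact Set.ncard_le_ncard (fun x hx => by simpa using (Finset.mem_filter.1 hx).2)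
  have hoff : (Finset.univ.erase r).filter (· ∉ A) = Finset.univ.filter (· ∉ A) := by
    ext x
    simp only [Finset.mem_filter, Finset.mem_erase, Finset.mem_univ, and_true, true_and,
      and_iff_right_iff_imp]
    rintro hx rfl
    exact hx hr
  have hmap : ((Finset.univ.filter (· ∉ A)).val.map fun x => s(x, g x)) =
      (Finset.univ.filter (· ∉ A)).val.map fun x => s(x, f x) :=
    Multiset.map_congr rfl fun x hx => by rw [h.off x (by simpa using hx)]
  have hsplit : ∀ (t : Finset (Fin n)) (φ : Fin n → Sym2 (Fin n)), t.val.map φ =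
      (t.filter (· ∈ A)).val.map φ + (t.filter (· ∉ A)).val.map φ := by
    intro t φ
    rw [← Multiset.map_add, Finset.filter_val, Finset.filter_val, Multiset.filter_add_not]
  rw [hg.graphEdges_eq, funEdges, hsplit, hsplit (Finset.univ.erase r), hoff, hmap]
  refine (msdCard_add_le _ _ _).trans ?_
  rw [Multiset.card_map, Multiset.card_map, two_mul]
  exact add_le_add (hcard _) (hcard _)

end EdgeCount

section RenyiJoyal

variable {n k : ℕ} {f f' : Fin n → Fin n} {T T' : DoublyRootedTree n}

/-- The Rényi–Joyal correspondence between self-maps and doubly rooted trees: concatenate the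
cycles of `f`, each ending in its maximum, in decreasing order of maxima, to form the path
from `r1` to `r2`. -/
def RenyiJoyal (f : Fin n → Fin n) (T : DoublyRootedTree n) : Prop :=
  ∃ g, IsShift (cycleMaxima f) f g T.r1 ∧ IsLeast (cycleMaxima f) T.r2 ∧ T.tree = parentGraph g

theorem exists_renyiJoyal_tree (hn : 0 < n) (f : Fin n → Fin n) : ∃ T, RenyiJoyal f T := by
  obtain ⟨a, ha, -⟩ := exists_reach_mem_cycleMaxima f ⟨0, hn⟩
  obtain ⟨r, hr⟩ := exists_isLeast ⟨a, ha⟩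
  obtain ⟨g, s, h⟩ := exists_isShift_of_source ⟨a, ha⟩ f
  exact ⟨⟨parentGraph g, (h.isParentMap hr).isTree, s, r⟩, g, h, hr, rfl⟩

theorem exists_renyiJoyal_map (T : DoublyRootedTree n) : ∃ f, RenyiJoyal f T := by
  obtain ⟨g, hg, hT⟩ := T.isTree.exists_parentMap T.r2
  have hr := hg.isLeast_orbitRecords T.r1
  obtain ⟨f, h⟩ := exists_isShift_of_target (A := orbitRecords g T.r1) g T.r1
    fun a ha => by rw [ha.unique hr, hg.1]
  have hA := hg.cycleMaxima_eq h
  exact ⟨f, g, hA ▸ h, hA ▸ hr, hT.symm⟩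

namespace RenyiJoyal

theorem tree_unique (h : RenyiJoyal f T) (h' : RenyiJoyal f T') : T = T' := by
  obtain ⟨g, hg, hr, hT⟩ := h
  obtain ⟨g', hg', hr', hT'⟩ := h'
  obtain ⟨rfl, hs⟩ := hg.target_unique ⟨_, hr.1⟩ hg'
  cases T
  cases T'
  simp only at hs hT hT'
  subst hs hT hT'
  congr
  exact hr.unique hr'

theorem map_unique (h : RenyiJoyal f T) (h' : RenyiJoyal f' T) : f = f' := by
  obtain ⟨g, hg, hr, hT⟩ := h
  obtain ⟨g', hg', hr', hT'⟩ := h'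
  obtain rfl := (hg.isParentMap hr).parentGraph_injective (hg'.isParentMap hr')
    (hT.symm.trans hT')
  have hA := hg'.orbitRecords_eq
  rw [hg.orbitRecords_eq] at hA
  exact hg.source_unique (hA ▸ hg')

theorem msdCard_le (h : RenyiJoyal f T) :
    msdCard (funEdges f) (graphEdges T.tree) ≤ 2 * cycleCount f := by
  obtain ⟨g, hg, hr, hT⟩ := h
  rw [hT]
  exact (hg.msdCard_le (hg.isParentMap hr) hr.1).trans
    (Nat.mul_le_mul_left 2 (ncard_cycleMaxima_le f))

theorem restricted_iff (h : RenyiJoyal f T) :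
    (∀ x : Fin n, (x : ℕ) < k → k ≤ (f x : ℕ)) ↔
      (∀ x y : Fin n, (x : ℕ) < k → (y : ℕ) < k → ¬ T.tree.Adj x y) ∧ k ≤ (T.r2 : ℕ) := by
  obtain ⟨g, hg, hr, hT⟩ := h
  have hpar := hg.isParentMap hr
  rw [hT]
  constructor
  · intro hf
    have hA : ∀ a ∈ cycleMaxima f, k ≤ (a : ℕ) := by
      intro a ha
      by_contra! hlt
      exact absurd ((hf a hlt).trans (Fin.le_def.1 (ha.2 _ (Reach.step f a)))) (by omega)
    have hgk : ∀ x : Fin n, (x : ℕ) < k → k ≤ (g x : ℕ) := by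
      intro x hx
      rw [hg.off x fun hxA => absurd (hA x hxA) (by omega)]
      exact hf x hx
    refine ⟨fun x y hx hy hxy => ?_, hA _ hr.1⟩
    obtain ⟨-, rfl | rfl⟩ := parentGraph_adj.1 hxy
    · exact absurd (hgk x hx) (by omega)
    · exact absurd (hgk y hy) (by omega)
  · rintro ⟨hind, hk⟩ x hx
    have hxA : x ∉ cycleMaxima f := fun hxA =>
      absurd (hk.trans (Fin.le_def.1 (hr.2 hxA))) (by omega)
    rw [← hg.off x hxA]
    by_contra! hlt
    refine hind x (g x) hx hlt (parentGraph_adj.2 ⟨fun h => ?_, Or.inl rfl⟩)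
    obtain rfl := hpar.eq_root_of_fixed h.symm
    exact hxA hr.1

end RenyiJoyal

end RenyiJoyal

theorem renyi_joyal_restricted (n k : ℕ) (hk : 1 ≤ k) (hkn : k < n) :
    ∃ R : {f : Fin n → Fin n // ∀ x : Fin n, (x : ℕ) < k → k ≤ (f x : ℕ)} ≃
        {T : DoublyRootedTree n //
          (∀ x y : Fin n, (x : ℕ) < k → (y : ℕ) < k → ¬ T.tree.Adj x y) ∧
          k ≤ (T.r2 : ℕ)},
      ∀ f : {f : Fin n → Fin n // ∀ x : Fin n, (x : ℕ) < k → k ≤ (f x : ℕ)},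
        msdCard (funEdges f.1) (graphEdges ((R f).1.tree)) ≤ 2 * cycleCount f.1 := by
  choose T hT using exists_renyiJoyal_tree (n := n) (by omega)
  refine ⟨Equiv.ofBijective (fun f => ⟨T f.1, (hT f.1).restricted_iff.1 f.2⟩) ⟨?_, ?_⟩,
    fun f => (hT f.1).msdCard_le⟩
  · intro f f' h
    have hTT : T f.1 = T f'.1 := congrArg Subtype.val h
    exact Subtype.ext ((hT f.1).map_unique (hTT ▸ hT f'.1))
  · rintro ⟨D, hD⟩
    obtain ⟨f, hf⟩ := exists_renyiJoyal_map D
    exact ⟨⟨f, hf.restricted_iff.2 hD⟩, Subtype.ext ((hT f).tree_unique hf)⟩
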